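/- arXiv:1505.00883 — 2 statements merged into one kernel-verified Lean document; each statement's English description precedes it below -/
import Mathlib

section
/- (Delta function expansion) Let p be a prime, d ≥ 1, and let E ⊆ (ZMod p)^d be a spectral set with spectrum A, with 0 ∈ E. Then for every x ∈ E, Σ_{a∈A} χ(x·a) equals |E| if x = 0 and equals 0 if x ≠ 0. -/
open Finset

/-- The additive character `χ(u) = exp(2πi u / p)` on `ZMod p`. -/
noncomputable def chi (p : ℕ) (u : ZMod p) : ℂ :=
  Complex.exp (2 * Real.pi * Complex.I * (u.val : ℂ) / (p : ℂ))

/-- Dot product on `(ZMod p)^d`. -/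
def dotp {p d : ℕ} (x m : Fin d → ZMod p) : ZMod p := ∑ j, x j * m j

/-- `(E, A)` is a spectral pair: `A` indexes an orthogonal basis of exponentials for `L²(E)`. -/
def IsSpectralPair (p d : ℕ) (E A : Finset (Fin d → ZMod p)) : Prop :=
  (∀ f : (Fin d → ZMod p) → ℂ, ∃ c : (Fin d → ZMod p) → ℂ,
      ∀ x ∈ E, f x = ∑ a ∈ A, c a * chi p (dotp x a)) ∧
  (∀ a ∈ A, ∀ a' ∈ A, a ≠ a' → ∑ x ∈ E, chi p (dotp x (a - a')) = 0)

/-- `(E, T)` is a tiling pair: every vector has a unique representation `e + t`. -/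
def IsTilingPair (p d : ℕ) (E T : Finset (Fin d → ZMod p)) : Prop :=
  ∀ v : Fin d → ZMod p, ∃! et : (Fin d → ZMod p) × (Fin d → ZMod p),
    et.1 ∈ E ∧ et.2 ∈ T ∧ v = et.1 + et.2

/-- `E` tiles `(ZMod p)^d` by translation. -/
def Tiles (p d : ℕ) (E : Finset (Fin d → ZMod p)) : Prop :=
  ∃ T : Finset (Fin d → ZMod p), IsTilingPair p d E T

theorem chi_eq_stdAddChar (p : ℕ) [NeZero p] (u : ZMod p) : chi p u = ZMod.stdAddChar u := by
  rw [ZMod.stdAddChar_apply, ZMod.toCircle_apply, chi]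

theorem chi_zero (p : ℕ) : chi p 0 = 1 := by
  simp [chi]

theorem chi_add (p : ℕ) [NeZero p] (u v : ZMod p) : chi p (u + v) = chi p u * chi p v := by
  simp only [chi_eq_stdAddChar, AddChar.map_add_eq_mul]

theorem dotp_zero_left {p d : ℕ} (m : Fin d → ZMod p) : dotp 0 m = 0 := by
  simp [dotp]

theorem dotp_zero_right {p d : ℕ} (x : Fin d → ZMod p) : dotp x 0 = 0 := by
  simp [dotp]

theorem dotp_sub_right {p d : ℕ} (x m n : Fin d → ZMod p) :
    dotp x (m - n) = dotp x m + -dotp x n := by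
  simp only [dotp, mul_sub, Pi.sub_apply, Finset.sum_sub_distrib, sub_eq_add_neg (∑ j, x j * m j)]

/-- The coefficients of an expansion over a spectrum are the Fourier coefficients. -/
theorem IsSpectralPair.card_mul_coeff {p d : ℕ} [NeZero p] {E A : Finset (Fin d → ZMod p)}
    (hspec : IsSpectralPair p d E A) {f c : (Fin d → ZMod p) → ℂ}
    (hc : ∀ x ∈ E, f x = ∑ a ∈ A, c a * chi p (dotp x a)) {b : Fin d → ZMod p} (hb : b ∈ A) :
    (E.card : ℂ) * c b = ∑ x ∈ E, f x * chi p (-dotp x b) := by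
  symm
  calc ∑ x ∈ E, f x * chi p (-dotp x b)
      = ∑ x ∈ E, ∑ a ∈ A, c a * chi p (dotp x (a - b)) := by
        refine Finset.sum_congr rfl fun x hx => ?_
        rw [hc x hx, Finset.sum_mul]
        simp only [dotp_sub_right, chi_add, mul_assoc]
    _ = ∑ a ∈ A, c a * ∑ x ∈ E, chi p (dotp x (a - b)) := by
        rw [Finset.sum_comm]
        simp only [Finset.mul_sum]
    _ = c b * ∑ x ∈ E, chi p (dotp x (b - b)) :=
        Finset.sum_eq_single_of_mem b hb fun a ha hab => by
          rw [hspec.2 a ha b hb hab, mul_zero]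
    _ = (E.card : ℂ) * c b := by
        simp [dotp_zero_right, chi_zero, mul_comm]

theorem delta_function_expansion (p d : ℕ) (hp : p.Prime) (hd : 1 ≤ d)
    (E A : Finset (Fin d → ZMod p)) (hspec : IsSpectralPair p d E A)
    (h0 : (0 : Fin d → ZMod p) ∈ E) :
    ∀ x ∈ E, ∑ a ∈ A, chi p (dotp x a) = if x = 0 then (E.card : ℂ) else 0 := by
  have : NeZero p := ⟨hp.ne_zero⟩
  obtain ⟨c, hc⟩ := hspec.1 (fun x => if x = 0 then 1 else 0)
  have hcoeff : ∀ b ∈ A, (E.card : ℂ) * c b = 1 := fun b hb => by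
    rw [hspec.card_mul_coeff hc hb]
    simp [h0, dotp_zero_left, chi_zero]
  intro x hx
  calc ∑ a ∈ A, chi p (dotp x a)
      = (E.card : ℂ) * ∑ a ∈ A, c a * chi p (dotp x a) := by
        rw [Finset.mul_sum]
        refine Finset.sum_congr rfl fun a ha => ?_
        rw [← mul_assoc, hcoeff a ha, one_mul]
    _ = if x = 0 then (E.card : ℂ) else 0 := by
        rw [← hc x hx, mul_ite, mul_one, mul_zero]
end

section
/- (Dilation invariance of the zero set of the Fourier transform) Let p be a prime, d ≥ 1, E ⊆ (ZMod p)^d, and m ∈ (ZMod p)^d with m ≠ 0. If Σ_{x∈E} χ(x·m) = 0, then Σ_{x∈E} χ(x·(r m)) = 0 for every nonzero r ∈ ZMod p. -/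
open Finset

lemma chi_eq_pow (p : ℕ) (u : ZMod p) :
    chi p u = Complex.exp (2 * Real.pi * Complex.I / p) ^ u.val := by
  rw [chi, ← Complex.exp_nat_mul]
  congr 1
  ring

lemma chi_mul {p : ℕ} (hp : p ≠ 0) (r u : ZMod p) :
    chi p (r * u) = (Complex.exp (2 * Real.pi * Complex.I / p) ^ r.val) ^ u.val := by
  have h := (Complex.isPrimitiveRoot_exp p hp).pow_eq_one
  rw [chi_eq_pow, ZMod.val_mul, ← pow_mul, pow_eq_pow_mod (r.val * u.val) h]

lemma dotp_smul {p d : ℕ} (r : ZMod p) (x m : Fin d → ZMod p) :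
    dotp x (r • m) = r * dotp x m := by
  simp only [dotp, Pi.smul_apply, smul_eq_mul, mul_sum]
  exact sum_congr rfl fun j _ => by ring

/-- A rational polynomial vanishing at one primitive `n`-th root of unity vanishes at all. -/
lemma IsPrimitiveRoot.aeval_eq_zero_of_aeval_eq_zero {K : Type*} [Field K] [CharZero K] {n : ℕ}
    (hn : 0 < n) {ζ ξ : K} (hζ : IsPrimitiveRoot ζ n) (hξ : IsPrimitiveRoot ξ n)
    {P : Polynomial ℚ} (hP : Polynomial.aeval ζ P = 0) : Polynomial.aeval ξ P = 0 := by
  rw [← minpoly.dvd_iff, ← Polynomial.cyclotomic_eq_minpoly_rat hξ hn,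
    Polynomial.cyclotomic_eq_minpoly_rat hζ hn, minpoly.dvd_iff]
  exact hP

theorem fourier_zero_dilation_invariant (p d : ℕ) (hp : p.Prime) (hd : 1 ≤ d)
    (E : Finset (Fin d → ZMod p)) (m : Fin d → ZMod p) (hm : m ≠ 0)
    (hzero : ∑ x ∈ E, chi p (dotp x m) = 0) :
    ∀ r : ZMod p, r ≠ 0 → ∑ x ∈ E, chi p (dotp x (r • m)) = 0 := by
  intro r hr
  have : Fact p.Prime := ⟨hp⟩
  have hζ := Complex.isPrimitiveRoot_exp p hp.ne_zero
  have hcop : r.val.Coprime p :=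
    (Nat.coprime_of_lt_prime (by rwa [Ne, ZMod.val_eq_zero]) (ZMod.val_lt r) hp).symm
  have key := hζ.aeval_eq_zero_of_aeval_eq_zero hp.pos (hζ.pow_of_coprime r.val hcop)
    (P := ∑ x ∈ E, Polynomial.X ^ (dotp x m).val)
    (by simpa only [map_sum, map_pow, Polynomial.aeval_X, ← chi_eq_pow] using hzero)
  simpa only [map_sum, map_pow, Polynomial.aeval_X, ← chi_mul hp.ne_zero, ← dotp_smul] using key
end
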